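/- Let f : K → ℝ be a discrete Morse function on a CW complex K. Then for every cell σ of K, U(σ) + D(σ) ≤ 1. -/

import Mathlib

/-!
Set-based CW complexes: a CW complex is identified with the family of its cells.
Each `n`-cell `τ` has a characteristic map `charMap τ : D^n → X` (from the closed
unit disk of `EuclideanSpace ℝ (Fin n)`), the open cells partition `X`, the closure
of each cell is the image of the closed disk, the boundary sphere is mapped into
finitely many cells of strictly lower dimension (closure finiteness), and `X`
carries the weak topology determined by the closed cells.
-/

open Metric Set

structure CWComplexCells (X : Type) [TopologicalSpace X] [T2Space X] where
  /-- The (index type of the) cells of the complex. -/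
  Cell : Type
  /-- The dimension of each cell. -/
  dim : Cell → ℕ
  /-- The characteristic map of each cell. -/
  charMap : (τ : Cell) → EuclideanSpace ℝ (Fin (dim τ)) → X
  charMap_continuousOn : ∀ τ, ContinuousOn (charMap τ) (closedBall 0 1)
  charMap_injOn : ∀ τ, InjOn (charMap τ) (ball 0 1)
  /-- Distinct (open) cells are disjoint. -/
  cells_disjoint : ∀ σ τ : Cell, σ ≠ τ →
    Disjoint (charMap σ '' ball 0 1) (charMap τ '' ball 0 1)
  /-- The open cells cover the space. -/
  cells_cover : (⋃ τ : Cell, charMap τ '' ball 0 1) = univ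
  /-- The closure of an open cell is the image of the closed disk. -/
  closure_cell : ∀ τ, closure (charMap τ '' ball 0 1) = charMap τ '' closedBall 0 1
  /-- Closure finiteness: the boundary sphere of each cell is mapped into a finite
  union of cells of strictly smaller dimension. -/
  sphere_subset : ∀ τ, ∃ I : Set Cell, I.Finite ∧ (∀ σ ∈ I, dim σ < dim τ) ∧
    charMap τ '' sphere 0 1 ⊆ ⋃ σ ∈ I, charMap σ '' ball 0 1
  /-- Weak topology: a set is closed iff its intersection with each closed cell is closed. -/
  isClosed_iff : ∀ A : Set X, IsClosed A ↔ ∀ τ, IsClosed (A ∩ charMap τ '' closedBall 0 1)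

namespace CWComplexCells

variable {X : Type} [TopologicalSpace X] [T2Space X] (K : CWComplexCells X)

/-- The (open) cell of `τ`, as a subset of the space. -/
def cellSet (τ : K.Cell) : Set X := K.charMap τ '' ball 0 1

/-- `ν` is a face of `τ` (written `ν < τ`): `ν ⊆ cl(τ) \ τ`. -/
def Face (ν τ : K.Cell) : Prop :=
  K.cellSet ν ⊆ closure (K.cellSet τ) \ K.cellSet τ

/-- `ν` is a facet of `τ` (written `ν ≺ τ`): a face of codimension one. -/
def Facet (ν τ : K.Cell) : Prop := K.Face ν τ ∧ K.dim ν + 1 = K.dim τ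

/-- The preimage of the cell `σ` under the characteristic map of `τ`,
inside the closed disk. -/
def preim (σ τ : K.Cell) : Set (EuclideanSpace ℝ (Fin (K.dim τ))) :=
  closedBall 0 1 ∩ K.charMap τ ⁻¹' K.cellSet σ

/-- `σ` is a regular face of `τ`: `σ < τ`, the restriction
`charMap τ : charMap τ ⁻¹(σ) → σ` is a homeomorphism, and the closure of
`charMap τ ⁻¹(σ)` is a closed `(dim σ)`-ball. -/
def RegularFace (σ τ : K.Cell) : Prop :=
  K.Face σ τ ∧
  (∃ e : K.preim σ τ ≃ₜ K.cellSet σ,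
    ∀ x : K.preim σ τ, (e x : X) = K.charMap τ (x : EuclideanSpace ℝ (Fin (K.dim τ)))) ∧
  Nonempty ((closure (K.preim σ τ)) ≃ₜ
    (closedBall (0 : EuclideanSpace ℝ (Fin (K.dim σ))) 1))

/-- `σ` is an irregular face of `τ`. -/
def IrregularFace (σ τ : K.Cell) : Prop := K.Face σ τ ∧ ¬ K.RegularFace σ τ

/-- `σ` is a regular facet of `τ`. -/
def RegularFacet (σ τ : K.Cell) : Prop := K.RegularFace σ τ ∧ K.dim σ + 1 = K.dim τ

/-- `σ` is an irregular facet of `τ`. -/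
def IrregularFacet (σ τ : K.Cell) : Prop := K.Facet σ τ ∧ ¬ K.RegularFace σ τ

/-- The set of upper noncritical neighbours of `σ`:
`(k+1)`-cells `τ` with `σ ≺ τ` and `f σ ≥ f τ`. -/
def Uset (f : K.Cell → ℝ) (σ : K.Cell) : Set K.Cell :=
  {τ | K.Facet σ τ ∧ f σ ≥ f τ}

/-- The set of lower noncritical neighbours of `σ`:
`(k-1)`-cells `ν` with `ν ≺ σ` and `f ν ≥ f σ`. -/
def Dset (f : K.Cell → ℝ) (σ : K.Cell) : Set K.Cell :=
  {ν | K.Facet ν σ ∧ f ν ≥ f σ}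

/-- `U(σ)`. -/
noncomputable def U (f : K.Cell → ℝ) (σ : K.Cell) : ℕ∞ := (K.Uset f σ).encard

/-- `D(σ)`. -/
noncomputable def D (f : K.Cell → ℝ) (σ : K.Cell) : ℕ∞ := (K.Dset f σ).encard

/-- `f` is a discrete Morse function. -/
def DiscreteMorse (f : K.Cell → ℝ) : Prop :=
  ∀ σ : K.Cell,
    (∀ τ, K.IrregularFacet σ τ → f σ < f τ) ∧
    K.U f σ ≤ 1 ∧
    (∀ ν, K.IrregularFacet ν σ → f ν < f σ) ∧
    K.D f σ ≤ 1

/-- Two cells are adjacent if one is a facet of the other. -/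
def Adjacent (σ τ : K.Cell) : Prop := K.Facet σ τ ∨ K.Facet τ σ

/-- There is an `r`-path from `σ` to `τ`: a sequence of cells on the level set
`f⁻¹(r)` in which consecutive cells are facets of one another. -/
def RPath (f : K.Cell → ℝ) (r : ℝ) (σ τ : K.Cell) : Prop :=
  f σ = r ∧ Relation.ReflTransGen (fun a b => K.Adjacent a b ∧ f b = r) σ τ

/-- A family of cells contained in one level set of `f` whose members are
pairwise joined by `c`-paths. -/
def IsPreCollection (f : K.Cell → ℝ) (C : Set K.Cell) : Prop :=
  ∃ c : ℝ, (∀ σ ∈ C, f σ = c) ∧ ∀ σ ∈ C, ∀ τ ∈ C, K.RPath f c σ τ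

/-- A collection for `f`: a maximal family of cells contained in one level set
of `f` whose members are pairwise joined by `c`-paths. -/
def IsCollection (f : K.Cell → ℝ) (C : Set K.Cell) : Prop :=
  K.IsPreCollection f C ∧ ∀ C', C ⊆ C' → K.IsPreCollection f C' → C' = C

/-- The set counted by `U^C(σ)`. -/
def UCset (f : K.Cell → ℝ) (C : Set K.Cell) (σ : K.Cell) : Set K.Cell :=
  {τ | τ ∉ C ∧ K.Facet σ τ ∧ f σ ≥ f τ}

/-- The set counted by `D^C(σ)`. -/
def DCset (f : K.Cell → ℝ) (C : Set K.Cell) (σ : K.Cell) : Set K.Cell :=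
  {ν | ν ∉ C ∧ K.Facet ν σ ∧ f ν ≥ f σ}

/-- `U^C(σ)`. -/
noncomputable def UC (f : K.Cell → ℝ) (C : Set K.Cell) (σ : K.Cell) : ℕ∞ :=
  (K.UCset f C σ).encard

/-- `D^C(σ)`. -/
noncomputable def DC (f : K.Cell → ℝ) (C : Set K.Cell) (σ : K.Cell) : ℕ∞ :=
  (K.DCset f C σ).encard

/-- `f` is a discrete Morse–Bott function. -/
def DiscreteMorseBott (f : K.Cell → ℝ) : Prop :=
  ∀ C : Set K.Cell, K.IsCollection f C → ∀ σ ∈ C,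
    (∀ τ, K.IrregularFace σ τ → f σ < f τ) ∧
    K.UC f C σ ≤ 1 ∧
    (∀ ν, K.IrregularFace ν σ → f ν < f σ) ∧
    K.DC f C σ ≤ 1

/-- The reduced collection `C^red`: delete from `C` all upward noncritical cells
(those with `U^C(σ) = 1`) and all downward noncritical cells (those with `D^C(σ) = 1`). -/
def red (f : K.Cell → ℝ) (C : Set K.Cell) : Set K.Cell :=
  {σ ∈ C | K.UC f C σ ≠ 1 ∧ K.DC f C σ ≠ 1}

end CWComplexCells


section BrouwerAux
open MeasureTheory

theorem aux_det_poly {E : Type*} [NormedAddCommGroup E] [NormedSpace ℝ E] [FiniteDimensional ℝ E]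
    (M : E →L[ℝ] E) : ∃ p : Polynomial ℝ, p.natDegree ≤ Module.finrank ℝ E ∧
      ∀ t : ℝ, p.eval t = (ContinuousLinearMap.id ℝ E + t • M).det := by
  classical
  let b := Module.finBasis ℝ E
  let A := LinearMap.toMatrix b b (M : E →ₗ[ℝ] E)
  refine ⟨((Polynomial.X : Polynomial ℝ) • A.map Polynomial.C
    + (1 : Matrix _ _ ℝ).map Polynomial.C).det, ?_, ?_⟩
  · simpa using Polynomial.natDegree_det_X_add_C_le A 1
  · intro t
    rw [← Polynomial.coe_evalRingHom, RingHom.map_det, ContinuousLinearMap.det,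
      ← LinearMap.det_toMatrix b]
    congr 1
    ext i j
    simp [A, Matrix.one_apply, LinearMap.toMatrix_apply, Finsupp.single_apply, eq_comm]
    split_ifs <;> simp <;> ring

/-- extension by zero of a Lipschitz map vanishing on the sphere -/
theorem aux_lip_ext {E : Type*} [NormedAddCommGroup E] [InnerProductSpace ℝ E]
    (u : E → E) (R : ℝ) (C : NNReal) (hu : LipschitzOnWith C u (closedBall 0 R))
    (h0 : ∀ x, ‖x‖ = R → u x = 0) :
    LipschitzWith C (fun x => by classical exact if ‖x‖ ≤ R then u x else 0) := by
  classical
  have key : ∀ x z : E, ‖x‖ ≤ R → R < ‖z‖ → ‖u x‖ ≤ C * ‖x - z‖ := by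
    intro x z hx hz
    obtain ⟨t, ht, hw⟩ : ∃ t ∈ Icc (0:ℝ) 1, ‖x + t • (z - x)‖ = R := by
      have hc : ContinuousOn (fun t : ℝ => ‖x + t • (z - x)‖) (Icc 0 1) := by fun_prop
      have := intermediate_value_Icc (zero_le_one) hc
      exact this ⟨by simpa using hx, by simpa using hz.le⟩
    have h1 := hu.norm_sub_le (x := x) (y := x + t • (z - x)) (by simpa using hx)
      (by simp [hw])
    rw [h0 _ hw, sub_zero] at h1
    refine h1.trans ?_
    gcongr
    have : x - (x + t • (z - x)) = t • (x - z) := by module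
    rw [this, norm_smul, Real.norm_of_nonneg ht.1]
    exact mul_le_of_le_one_left (norm_nonneg _) ht.2
  apply LipschitzWith.of_dist_le_mul
  intro x z
  rw [dist_eq_norm, dist_eq_norm]
  by_cases hx : ‖x‖ ≤ R <;> by_cases hz : ‖z‖ ≤ R <;> simp only [hx, hz, if_true, if_false]
  · exact hu.norm_sub_le (by simpa using hx) (by simpa using hz)
  · simpa using key x z hx (not_le.1 hz)
  · rw [norm_sub_rev x z]; simpa using key z x hz (not_le.1 hx)
  · simp; positivity

theorem aux_no_retraction {E : Type*} [NormedAddCommGroup E] [InnerProductSpace ℝ E]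
    [FiniteDimensional ℝ E] (r : E → E) (hr : ContDiff ℝ 1 r) (R : ℝ) (hR : 0 < R)
    (hn : ∀ x, ‖r x‖ = R) (hid : ∀ x, ‖x‖ = R → r x = x) : False := by
  classical
  borelize E
  let μ : Measure E := Measure.addHaar
  set B : Set E := closedBall 0 R with hB
  have hBc : IsCompact B := isCompact_closedBall _ _
  set u : E → E := fun x => r x - x with hu
  have huC : ContDiff ℝ 1 u := hr.sub contDiff_id
  have hdu : Differentiable ℝ u := huC.differentiable (by norm_num)
  have hcd : Continuous (fderiv ℝ u) := huC.continuous_fderiv (by norm_num)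
  obtain ⟨C0, hC0⟩ := hBc.exists_bound_of_continuousOn hcd.continuousOn
  set C : NNReal := ⟨max C0 1, by positivity⟩ with hC
  have hCpos : (1:ℝ) ≤ C := le_max_right _ _
  have hCb : ∀ x ∈ B, ‖fderiv ℝ u x‖ ≤ C := fun x hx => (hC0 x hx).trans (le_max_left _ _)
  have hlip : LipschitzOnWith C u B :=
    Convex.lipschitzOnWith_of_nnnorm_fderiv_le (𝕜 := ℝ) (fun x _ => hdu x) hCb (convex_closedBall _ _)
  have hext := aux_lip_ext u R C hlip (fun x hx => by simp [hu, hid x hx])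
  set ue : E → E := fun x => if ‖x‖ ≤ R then u x else 0 with hue
  -- determinant positivity near the identity
  obtain ⟨δ, hδ, hdet⟩ : ∃ δ > 0, ∀ A : E →L[ℝ] E, ‖A - ContinuousLinearMap.id ℝ E‖ < δ → 0 < A.det := by
    have h1 : ∀ᶠ A : E →L[ℝ] E in nhds (ContinuousLinearMap.id ℝ E), 0 < A.det := by
      apply (ContinuousLinearMap.continuous_det.continuousAt).eventually
        (lt_mem_nhds _)
      simp [ContinuousLinearMap.det]
    obtain ⟨δ, hδ, h⟩ := Metric.eventually_nhds_iff.1 h1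
    exact ⟨δ, hδ, fun A hA => h (by rwa [dist_eq_norm])⟩
  -- small parameters
  have hvol : ∀ t : ℝ, 0 < t → t ≤ 1 → t * C < 1 → t * C < δ →
      ∫ x in B, (ContinuousLinearMap.id ℝ E + t • fderiv ℝ u x).det ∂μ = μ.real B := by
    intro t ht ht1 htC htδ
    obtain ⟨s, hs⟩ : ∃ s : NNReal, (s : ℝ) = t := ⟨t.toNNReal, Real.coe_toNNReal t ht.le⟩
    have hL : ApproximatesLinearOn (fun x => x + t • ue x)
        ((ContinuousLinearEquiv.refl ℝ E : E ≃L[ℝ] E) : E →L[ℝ] E) univ (s * C) := by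
      intro x _ y _
      have h1 := hext.dist_le_mul x y
      rw [dist_eq_norm, dist_eq_norm] at h1
      have h2 : x + t • ue x - (y + t • ue y) - (x - y) = t • (ue x - ue y) := by module
      simp only [ContinuousLinearEquiv.coe_refl, ContinuousLinearMap.coe_id', id_eq]
      rw [h2, norm_smul, Real.norm_of_nonneg ht.le]
      rw [NNReal.coe_mul, hs, mul_assoc]
      gcongr
    have hsub : Subsingleton E ∨ s * C <
        ‖((ContinuousLinearEquiv.refl ℝ E).symm : E →L[ℝ] E)‖₊⁻¹ := by
      rcases subsingleton_or_nontrivial E with h | h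
      · exact Or.inl h
      · right
        have : ‖((ContinuousLinearEquiv.refl ℝ E).symm : E →L[ℝ] E)‖₊ = 1 := by
          apply NNReal.eq; simp
        rw [this, inv_one, ← NNReal.coe_lt_coe]
        simpa [hs] using htC
    have hinj := hL.injOn hsub
    have hsurj := hL.surjective hsub
    have hgi : InjOn (fun x => x + t • u x) B := by
      intro x hx y hy hxy
      have hx' : ‖x‖ ≤ R := by simpa [hB] using hx
      have hy' : ‖y‖ ≤ R := by simpa [hB] using hy
      exact hinj (mem_univ x) (mem_univ y) (by simpa [hue, hx', hy'] using hxy)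
    have himg : (fun x => x + t • u x) '' B = B := by
      apply Subset.antisymm
      · rintro _ ⟨x, hx, rfl⟩
        have hx' : ‖x‖ ≤ R := by simpa [hB] using hx
        have : x + t • u x = (1 - t) • x + t • r x := by simp only [hu]; module
        simp only [hB, mem_closedBall_zero_iff]
        rw [this]
        refine (norm_add_le _ _).trans ?_
        rw [norm_smul, norm_smul, hn, Real.norm_of_nonneg ht.le,
          Real.norm_of_nonneg (by linarith)]
        nlinarith
      · intro y hy
        have hy' : ‖y‖ ≤ R := by simpa [hB] using hy
        obtain ⟨x, hx⟩ := hsurj y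
        by_cases hxR : ‖x‖ ≤ R
        · exact ⟨x, by simpa [hB] using hxR, by simpa [hue, hxR] using hx⟩
        · exfalso
          simp [hue, hxR] at hx
          exact hxR (hx ▸ hy')
    have hcv := integral_image_eq_integral_abs_det_fderiv_smul μ (s := B)
      (f := fun x => x + t • u x)
      (f' := fun x => ContinuousLinearMap.id ℝ E + t • fderiv ℝ u x)
      (measurableSet_closedBall)
      (fun x _ => ((hasFDerivAt_id x).add ((hdu x).hasFDerivAt.const_smul t)).hasFDerivWithinAt)
      hgi (fun _ => (1:ℝ))
    rw [himg] at hcv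
    simp only [integral_const, smul_eq_mul, mul_one] at hcv
    rw [measureReal_restrict_apply_univ] at hcv
    rw [hcv]
    apply setIntegral_congr_fun measurableSet_closedBall
    intro x hx
    refine (abs_of_pos (hdet _ ?_)).symm
    rw [add_sub_cancel_left, norm_smul, Real.norm_of_nonneg ht.le]
    exact (mul_le_mul_of_nonneg_left (hCb x hx) ht.le).trans_lt htδ
  -- interpolation nodes
  set n := Module.finrank ℝ E
  obtain ⟨η, hη, hη1, hηC, hηδ⟩ : ∃ η : ℝ, 0 < η ∧ η ≤ 1 ∧ η * C < 1 ∧ η * C < δ := by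
    have hCp : (0:ℝ) < C := by linarith
    refine ⟨min (1/2) (δ/2) / C, by positivity, ?_, ?_, ?_⟩
    · rw [div_le_one hCp]; exact (min_le_left _ _).trans (by linarith)
    · rw [div_mul_cancel₀ _ hCp.ne']; exact (min_le_left _ _).trans_lt (by norm_num)
    · rw [div_mul_cancel₀ _ hCp.ne']; exact (min_le_right _ _).trans_lt (by linarith)
  let v : ℕ → ℝ := fun i => η / (i + 1)
  have hv : ∀ i, 0 < v i ∧ v i ≤ η := fun i => ⟨by positivity, by
    apply div_le_self hη.le; linarith [(Nat.cast_nonneg i : (0:ℝ) ≤ i)]⟩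
  have hvinj : InjOn v (Finset.range (n+1) : Set ℕ) := by
    intro i _ j _ hij
    simp only [v] at hij
    rw [div_eq_div_iff (by positivity) (by positivity)] at hij
    have := mul_left_cancel₀ hη.ne' hij
    exact_mod_cast (by linarith : (i:ℝ) = j)
  let c : ℕ → ℝ := fun i => (Lagrange.basis (Finset.range (n+1)) v i).eval 1
  have hcsum : ∑ i ∈ Finset.range (n+1), c i = 1 := by
    have := Lagrange.sum_basis hvinj ⟨0, by simp⟩
    have := congrArg (Polynomial.eval 1) this
    simpa [Polynomial.eval_finsetSum, c] using this
  have hint : ∀ x, (ContinuousLinearMap.id ℝ E + (1:ℝ) • fderiv ℝ u x).det =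
      ∑ i ∈ Finset.range (n+1), (ContinuousLinearMap.id ℝ E + v i • fderiv ℝ u x).det * c i := by
    intro x
    obtain ⟨p, hp, hpe⟩ := aux_det_poly (fderiv ℝ u x)
    have h1 := Lagrange.eq_interpolate (f := p) hvinj (by
      refine Polynomial.degree_le_natDegree.trans_lt ?_
      simp only [Finset.card_range]
      exact_mod_cast Nat.lt_succ_of_le hp)
    rw [Lagrange.interpolate_apply] at h1
    have h2 := congrArg (Polynomial.eval 1) h1
    rw [hpe, Polynomial.eval_finsetSum] at h2
    simpa [hpe, c] using h2
  have hzero : ∀ x, (ContinuousLinearMap.id ℝ E + (1:ℝ) • fderiv ℝ u x).det = 0 := by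
    intro x
    have hdr : Differentiable ℝ r := hr.differentiable (by norm_num)
    have e1 : ContinuousLinearMap.id ℝ E + (1:ℝ) • fderiv ℝ u x = fderiv ℝ r x := by
      have : fderiv ℝ u x = fderiv ℝ r x - ContinuousLinearMap.id ℝ E :=
        ((hdr x).hasFDerivAt.sub (hasFDerivAt_id x)).fderiv
      rw [this]; simp
    rw [e1]
    by_contra hne
    have hs : Function.Surjective (fderiv ℝ r x) := by
      have := (LinearMap.equivOfDetNeZero (fderiv ℝ r x : E →ₗ[ℝ] E) hne).surjective
      exact this
    obtain ⟨w, hw⟩ := hs (r x)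
    have h1 := ((hdr x).hasFDerivAt.inner ℝ (hdr x).hasFDerivAt)
    have h2 : (fun y => inner ℝ (r y) (r y)) = fun _ => R ^ 2 := by
      ext y; rw [real_inner_self_eq_norm_sq, hn]
    rw [h2] at h1
    have h3 := h1.unique (hasFDerivAt_const (R^2) x)
    have h4 := congrArg (fun L => L w) h3
    simp [hw, hn] at h4
    exact hR.ne' h4
  have hfin : (0:ℝ) = μ.real B := by
    calc (0:ℝ) = ∫ x in B, (ContinuousLinearMap.id ℝ E + (1:ℝ) • fderiv ℝ u x).det ∂μ := by
          simp only [hzero, integral_zero]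
      _ = ∫ x in B, ∑ i ∈ Finset.range (n+1),
            (ContinuousLinearMap.id ℝ E + v i • fderiv ℝ u x).det * c i ∂μ := by simp_rw [hint]
      _ = ∑ i ∈ Finset.range (n+1), ∫ x in B,
            (ContinuousLinearMap.id ℝ E + v i • fderiv ℝ u x).det * c i ∂μ := by
          apply integral_finsetSum
          intro i _
          apply ContinuousOn.integrableOn_compact hBc
          apply Continuous.continuousOn
          exact (ContinuousLinearMap.continuous_det.comp (by fun_prop)).mul continuous_const
      _ = ∑ i ∈ Finset.range (n+1), μ.real B * c i := by
          apply Finset.sum_congr rfl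
          intro i _
          rw [integral_mul_const, hvol (v i) (hv i).1 ((hv i).2.trans hη1)
            ((mul_le_mul_of_nonneg_right (hv i).2 C.2).trans_lt hηC)
            ((mul_le_mul_of_nonneg_right (hv i).2 C.2).trans_lt hηδ)]
      _ = μ.real B := by rw [← Finset.mul_sum, hcsum, mul_one]
  have hpos : 0 < μ B := measure_closedBall_pos μ 0 hR
  have : 0 < μ.real B := ENNReal.toReal_pos hpos.ne' hBc.measure_lt_top.ne
  linarith

/-- continuous version -/
theorem aux_brouwer {E : Type*} [NormedAddCommGroup E] [InnerProductSpace ℝ E]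
    [FiniteDimensional ℝ E] (V : E → E) (hV : ContinuousOn V (closedBall 0 1))
    (hne : ∀ x ∈ closedBall (0:E) 1, V x ≠ 0)
    (hb : ∀ x ∈ sphere (0:E) 1, ‖V x - x‖ < 1) : False := by
  set p : E → E := fun x => (max 1 ‖x‖)⁻¹ • x with hp
  have hm : ∀ x : E, 0 < max 1 ‖x‖ := fun x => lt_of_lt_of_le one_pos (le_max_left _ _)
  have hpc : Continuous p := by
    apply Continuous.smul _ continuous_id
    exact Continuous.inv₀ (by fun_prop) (fun x => (hm x).ne')
  have hpn : ∀ x, ‖p x‖ = ‖x‖ / max 1 ‖x‖ := by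
    intro x; rw [hp, norm_smul, norm_inv, Real.norm_of_nonneg (hm x).le]; ring
  have hpB : ∀ x, p x ∈ closedBall (0:E) 1 := by
    intro x; rw [mem_closedBall_zero_iff, hpn, div_le_one (hm x)]; exact le_max_right _ _
  have hp1 : ∀ x, ‖x‖ ≤ 1 → p x = x := by
    intro x hx; simp [hp, max_eq_left hx]
  have hp2 : ∀ x, 1 ≤ ‖x‖ → p x ∈ sphere (0:E) 1 := by
    intro x hx
    rw [mem_sphere_zero_iff_norm, hpn, max_eq_right hx, div_self]; linarith
  set c : E → ℝ := fun x => max 0 (min 1 (2 - ‖x‖)) with hc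
  set W : E → E := fun x => x + c x • (V (p x) - p x) with hW
  have hVp : Continuous (fun x => V (p x)) := hV.comp_continuous hpc hpB
  have hcc : Continuous c := by fun_prop
  have hWc : Continuous W := continuous_id.add (hcc.smul (hVp.sub hpc))
  have hWne : ∀ x, W x ≠ 0 := by
    intro x hx
    rcases le_total ‖x‖ 1 with h | h
    · have : c x = 1 := by simp only [hc]; rw [min_eq_left (by linarith)]; norm_num
      simp only [hW, this, hp1 x h] at hx
      apply hne x (by simpa using h)
      simpa using hx
    · have h1 : ‖c x • (V (p x) - p x)‖ < 1 := by
        rw [norm_smul, Real.norm_of_nonneg (le_max_left _ _)]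
        have hc1 : c x ≤ 1 := max_le zero_le_one (min_le_left _ _)
        exact (mul_le_of_le_one_left (norm_nonneg _) hc1).trans_lt (hb _ (hp2 x h))
      have h2 : x = - (c x • (V (p x) - p x)) := eq_neg_of_add_eq_zero_left hx
      rw [← norm_neg, ← h2] at h1
      linarith
  have hWid : ∀ x, 2 ≤ ‖x‖ → W x = x := by
    intro x hx
    have : c x = 0 := by simp only [hc]; rw [max_eq_left]; exact (min_le_right _ _).trans (by linarith)
    simp [hW, this]
  obtain ⟨g, hg, hgd, hge, -⟩ := hWc.exists_contDiff_approx_and_eqOn 1 (ε := fun x => ‖W x‖)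
    hWc.norm (fun x => norm_pos_iff.2 (hWne x)) (S := {x | 3 ≤ ‖x‖}) (U := {x | 2 < ‖x‖})
    (isClosed_le continuous_const continuous_norm)
    ((isOpen_lt continuous_const continuous_norm).mem_nhdsSet.2 (fun x hx => by
      simp only [mem_ofPred_eq] at *; linarith))
    (contDiffOn_id.congr (fun x hx => hWid x (le_of_lt hx)))
  have hgne : ∀ x, g x ≠ 0 := by
    intro x hx
    have := hgd x
    rw [hx, dist_zero_left] at this
    exact lt_irrefl _ this
  apply aux_no_retraction (fun x => (3 / ‖g x‖) • g x) ?_ 3 (by norm_num) ?_ ?_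
  · exact (contDiff_const.div (hg.norm ℝ hgne) (fun x => (norm_pos_iff.2 (hgne x)).ne')).smul hg
  · intro x
    rw [norm_smul, norm_div, norm_norm, div_mul_cancel₀ _ (norm_pos_iff.2 (hgne x)).ne']; norm_num
  · intro x hx
    have : g x = x := (hge (show 3 ≤ ‖x‖ by rw [hx])).trans (hWid x (by rw [hx]; norm_num))
    simp only [this, hx]; norm_num

end BrouwerAux

section SphereAux
open MeasureTheory

theorem aux_pick {F : Type*} [NormedAddCommGroup F] [InnerProductSpace ℝ F] [FiniteDimensional ℝ F]
    (Q : F → F) (hQ : Continuous Q) (ε d : ℝ) (hε : 0 < ε) (hd : 0 < d) :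
    ∃ P : F → F, Continuous P ∧ (∀ x, ‖P x - Q x‖ < d) ∧ ∀ x, ‖x‖ = ε → P x ≠ 0 := by
  borelize F
  let μ : Measure F := Measure.addHaar
  obtain ⟨Q1, hQ1, hd1, -⟩ := hQ.exists_contDiff_approx 1 (ε := fun _ => d / 2)
    continuous_const (fun _ => by positivity)
  have h0 : μ (Q1 '' sphere 0 ε) = 0 :=
    addHaar_image_eq_zero_of_differentiableOn_of_addHaar_eq_zero μ
      (hQ1.differentiable (by norm_num)).differentiableOn
      (Measure.addHaar_sphere_of_ne_zero μ 0 hε.ne')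
  obtain ⟨a, ha, ha'⟩ : ∃ a ∈ ball (0:F) (d/2), a ∉ Q1 '' sphere 0 ε := by
    by_contra hcon
    push Not at hcon
    have : μ (ball (0:F) (d/2)) ≤ 0 := h0 ▸ measure_mono hcon
    exact absurd this (not_le.2 (measure_ball_pos μ 0 (by positivity)))
  refine ⟨fun x => Q1 x - a, hQ1.continuous.sub continuous_const, ?_, ?_⟩
  · intro x
    have h1 := hd1 x
    rw [dist_eq_norm] at h1
    have h2 : ‖a‖ < d / 2 := by simpa using ha
    have : Q1 x - a - Q x = (Q1 x - Q x) - a := by abel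
    rw [this]
    exact (norm_sub_le _ _).trans_lt (by linarith)
  · intro x hx h
    exact ha' ⟨x, by simpa using hx, sub_eq_zero.1 h⟩

theorem aux_sphere1 {E F : Type*} [NormedAddCommGroup E] [InnerProductSpace ℝ E]
    [NormedAddCommGroup F] [InnerProductSpace ℝ F] [FiniteDimensional ℝ F]
    (G : E → F) (hG : ContinuousOn G (sphere 0 1)) (x0 : E) (hx0 : ‖x0‖ = 1) (hz : G x0 = 0)
    (huniq : ∀ x, ‖x‖ = 1 → G x = 0 → x = x0)
    (j : F → E) (hj : ContinuousOn j (closedBall 0 1)) (hjs : ∀ v, ‖v‖ ≤ 1 → ‖j v‖ = 1)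
    (hj0 : j 0 = x0) (hinj : InjOn (fun v => G (j v)) (closedBall 0 1)) : False := by
  classical
  set B : Set F := closedBall 0 1 with hB
  have hBc : IsCompact B := isCompact_closedBall _ _
  set h : F → F := fun v => G (j v) with hh
  have hmaps : MapsTo j B (sphere 0 1) := fun v hv => by
    simpa using hjs v (by simpa [hB] using hv)
  have hhc : ContinuousOn h B := hG.comp hj hmaps
  have h00 : h 0 = 0 := by simp [hh, hj0, hz]
  have h0B : (0:F) ∈ B := by simp [hB]
  obtain ⟨ε, hε, hεs⟩ : ∃ ε > 0, ∀ v ∈ sphere (0:F) 1, ε ≤ ‖h v‖ := by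
    apply IsCompact.exists_forall_le' (isCompact_sphere _ _)
      ((hhc.mono sphere_subset_closedBall).norm)
    intro v hv
    rw [norm_pos_iff]
    intro hv0
    have := hinj (sphere_subset_closedBall hv) h0B (hv0.trans h00.symm)
    simp [this] at hv
  set l : E → ℝ := fun x => 2 * max 0 (1 - ‖G x‖ / ε) with hl
  have hl0 : ∀ x, 0 ≤ l x := fun x => by positivity
  have hlx0 : l x0 = 2 := by simp [hl, hz]
  have hlc : ContinuousOn l (sphere 0 1) := by
    apply continuousOn_const.mul
    apply ContinuousOn.sup continuousOn_const
    exact continuousOn_const.sub (hG.norm.div_const _)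
  set m : E → E := fun x => x - l x • x0 with hm
  have hmc : ContinuousOn m (sphere 0 1) := continuousOn_id.sub (hlc.smul continuousOn_const)
  have hkey : ∀ x, ‖x‖ = 1 → ∀ c : ℝ, 0 ≤ c → m x ≠ c • x0 := by
    intro x hx c hc h1
    have h2 : x = (l x + c) • x0 := by
      rw [add_smul, ← h1]; simp [hm]
    have h3 : l x + c = 1 := by
      have := congrArg norm h2
      rw [hx, norm_smul, hx0, Real.norm_of_nonneg (add_nonneg (hl0 x) hc)] at this
      linarith
    rw [h3, one_smul] at h2
    rw [h2, hlx0] at h3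
    linarith
  have hmne : ∀ x, ‖x‖ = 1 → m x ≠ 0 := fun x hx h1 => hkey x hx 0 le_rfl (by simp [h1])
  set H : E → F := fun x => G (‖m x‖⁻¹ • m x) with hH
  have hns : ∀ x, ‖x‖ = 1 → ‖‖m x‖⁻¹ • m x‖ = 1 := by
    intro x hx
    rw [norm_smul, norm_inv, norm_norm, inv_mul_cancel₀]
    exact norm_ne_zero_iff.2 (hmne x hx)
  have hHc : ContinuousOn H (sphere 0 1) := by
    apply hG.comp
    · apply ContinuousOn.smul _ hmc
      exact hmc.norm.inv₀ (fun x hx => norm_ne_zero_iff.2 (hmne x (by simpa using hx)))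
    · intro x hx
      simpa using hns x (by simpa using hx)
  have hHne : ∀ x, ‖x‖ = 1 → H x ≠ 0 := by
    intro x hx h1
    have h2 := huniq _ (hns x hx) h1
    apply hkey x hx ‖m x‖ (norm_nonneg _)
    rw [← h2, smul_smul, mul_inv_cancel₀ (norm_ne_zero_iff.2 (hmne x hx)), one_smul]
  have hHeq : ∀ x, ‖x‖ = 1 → ε ≤ ‖G x‖ → H x = G x := by
    intro x hx h1
    have h2 : l x = 0 := by
      have : 1 ≤ ‖G x‖ / ε := by rwa [le_div_iff₀ hε, one_mul]
      simp only [hl]; rw [max_eq_left (by linarith)]; simp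
    have h3 : m x = x := by simp [hm, h2]
    simp only [hH, h3, hx]; simp
  set H' : F → F := fun v => if ε ≤ ‖h v‖ then h v else (ε / ‖H (j v)‖) • H (j v) with hH'
  have hHj : ContinuousOn (fun v => H (j v)) B := hHc.comp hj hmaps
  have hH'c : ContinuousOn H' B := by
    rw [continuousOn_iff_continuous_domRestrict] at hhc hHj ⊢
    refine Continuous.if_le hhc ?_ continuous_const hhc.norm ?_
    · exact (continuous_const.div hHj.norm (fun v => norm_ne_zero_iff.2
        (hHne _ (hjs v (mem_closedBall_zero_iff.1 v.2))))).smul hHj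
    · intro v hv
      have h1 : H (j v) = h v := hHeq _ (hjs v (mem_closedBall_zero_iff.1 v.2)) hv.le
      have h2 : ε = ‖h v‖ := hv
      change h v = (ε / ‖H (j v)‖) • H (j v)
      rw [h1, ← h2, div_self hε.ne', one_smul]
  obtain ⟨Q, hQ⟩ : ∃ Q : C(F, F), ∀ v ∈ B, Q (h v) = v := by
    have : CompactSpace B := isCompact_iff_compactSpace.1 hBc
    have hc : Continuous (B.domRestrict h) := continuousOn_iff_continuous_domRestrict.1 hhc
    have he : Topology.IsClosedEmbedding (B.domRestrict h) :=
      hc.isClosedEmbedding (injOn_iff_injective.1 hinj)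
    have : TietzeExtension F := TietzeExtension.of_tvs ℝ
    obtain ⟨Q, hQ⟩ := ContinuousMap.exists_extension' he (⟨Subtype.val, continuous_subtype_val⟩ : C(B, F))
    exact ⟨Q, fun v hv => congrFun hQ ⟨v, hv⟩⟩
  obtain ⟨d, hd, hd1, hdv⟩ : ∃ d > 0, d ≤ 1 ∧ ∀ v ∈ B, ε ≤ ‖h v‖ → d ≤ ‖v‖ := by
    have hcl : IsClosed (B ∩ (fun v => ‖h v‖) ⁻¹' Ici ε) :=
      hhc.norm.preimage_isClosed_of_isClosed hBc.isClosed isClosed_Ici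
    have hcp : IsCompact (B ∩ (fun v => ‖h v‖) ⁻¹' Ici ε) := hBc.of_isClosed_subset hcl inter_subset_left
    obtain ⟨d, hd, hdv⟩ := hcp.exists_forall_le' (f := fun v => ‖v‖) (a := 0) continuous_norm.continuousOn (by
      rintro v ⟨hv, hv2⟩
      rw [norm_pos_iff]
      rintro rfl
      have : ε ≤ ‖h 0‖ := hv2
      rw [h00, norm_zero] at this
      linarith)
    exact ⟨min d 1, by positivity, min_le_right _ _, fun v hv h1 => (min_le_left _ _).trans (hdv v ⟨hv, h1⟩)⟩
  obtain ⟨P, hPc, hPQ, hPne⟩ := aux_pick Q Q.continuous ε d hε hd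
  apply aux_brouwer (fun v => P (H' v)) (hPc.comp_continuousOn hH'c)
  · intro v hv h1
    by_cases hc : ε ≤ ‖h v‖
    · simp only [hH', hc, if_true] at h1
      have := hPQ (h v)
      rw [h1, hQ v hv, zero_sub, norm_neg] at this
      linarith [hdv v hv hc]
    · simp only [hH', hc, if_false] at h1
      have hne := norm_ne_zero_iff.2 (hHne _ (hjs v (by simpa [hB] using hv)))
      refine hPne _ ?_ h1
      rw [norm_smul, norm_div, norm_norm, div_mul_cancel₀ _ hne, Real.norm_of_nonneg hε.le]
  · intro v hv
    have hc := hεs v hv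
    have h1 := hPQ (h v)
    rw [hQ v (sphere_subset_closedBall hv)] at h1
    simp only [hH', hc, if_true]
    linarith

theorem aux_sphere {E F : Type*} [NormedAddCommGroup E] [InnerProductSpace ℝ E]
    [FiniteDimensional ℝ E]
    [NormedAddCommGroup F] [InnerProductSpace ℝ F] [FiniteDimensional ℝ F]
    (hdim : Module.finrank ℝ E = Module.finrank ℝ F + 1)
    (G : E → F) (hG : ContinuousOn G (sphere 0 1)) (x0 : E) (hx0 : ‖x0‖ = 1) (hz : G x0 = 0)
    (huniq : ∀ x, ‖x‖ = 1 → G x = 0 → x = x0)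
    (O : Set E) (hO : O ∈ nhdsWithin x0 (sphere 0 1)) (hinj : InjOn G (O ∩ sphere 0 1)) : False := by
  obtain ⟨L, hL⟩ : ∃ L : F →ₗᵢ[ℝ] E, ∀ v, inner ℝ x0 (L v) = 0 := by
    have : Fact (Module.finrank ℝ E = Module.finrank ℝ F + 1) := ⟨hdim⟩
    have hne : x0 ≠ 0 := by rintro rfl; simp at hx0
    have h1 := Submodule.finrank_orthogonal_span_singleton (𝕜 := ℝ) (n := Module.finrank ℝ F) hne
    let e : F ≃ₗᵢ[ℝ] (Submodule.span ℝ {x0})ᗮ := 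
      (stdOrthonormalBasis ℝ F).equiv (stdOrthonormalBasis ℝ _) (finCongr h1.symm)
    refine ⟨(Submodule.subtypeₗᵢ _).comp e.toLinearIsometry, fun v => ?_⟩
    exact Submodule.mem_orthogonal_singleton_iff_inner_right.1 (e v).2
  set j1 : F → E := fun v => √(1 - ‖v‖^2) • x0 + L v with hj1
  have hj1c : Continuous j1 := by
    apply Continuous.add _ L.continuous
    exact Continuous.smul (by fun_prop) continuous_const
  have hj10 : j1 0 = x0 := by simp [hj1]
  have hj1n : ∀ v, ‖v‖ ≤ 1 → ‖j1 v‖ = 1 := by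
    intro v hv
    have h1 : ‖j1 v‖^2 = 1 := by
      rw [hj1, norm_add_sq_real, norm_smul, inner_smul_left, hL, hx0, L.norm_map, mul_one,
        Real.norm_of_nonneg (Real.sqrt_nonneg _), Real.sq_sqrt (by nlinarith [norm_nonneg v])]
      simp
    nlinarith [norm_nonneg (j1 v)]
  have hj1i : Function.Injective j1 := by
    intro v w hvw
    have h1 := congrArg (inner ℝ x0) hvw
    simp only [hj1, inner_add_right, hL, inner_smul_right, real_inner_self_eq_norm_sq, hx0] at h1
    have h2 : √(1 - ‖v‖^2) = √(1 - ‖w‖^2) := by linarith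
    simp only [hj1, h2] at hvw
    exact L.injective (add_left_cancel hvw)
  obtain ⟨U, hU, hUO⟩ := mem_nhdsWithin_iff_exists_mem_nhds_inter.1 hO
  have hpre : j1 ⁻¹' U ∈ nhds (0:F) := hj1c.continuousAt.preimage_mem_nhds (by rwa [hj10])
  obtain ⟨δ, hδ, hball⟩ := Metric.mem_nhds_iff.1 hpre
  set s := min (δ/2) 1 with hs
  have hs0 : 0 < s := by positivity
  have hs1 : s ≤ 1 := min_le_right _ _
  have hsv : ∀ v : F, ‖v‖ ≤ 1 → ‖s • v‖ ≤ s := by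
    intro v hv
    rw [norm_smul, Real.norm_of_nonneg hs0.le]
    exact mul_le_of_le_one_right hs0.le hv
  apply aux_sphere1 G hG x0 hx0 hz huniq (fun v => j1 (s • v))
    (hj1c.comp (continuous_const_smul s)).continuousOn
    (fun v hv => hj1n _ ((hsv v hv).trans hs1)) (by simp [hj10])
  intro v hv w hw hvw
  have hmem : ∀ v ∈ closedBall (0:F) 1, j1 (s • v) ∈ O ∩ sphere 0 1 := by
    intro v hv
    have hv' : ‖v‖ ≤ 1 := by simpa using hv
    have h1 : j1 (s • v) ∈ sphere (0:E) 1 := by simpa using hj1n _ ((hsv v hv').trans hs1)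
    refine ⟨hUO ⟨hball ?_, h1⟩, h1⟩
    rw [mem_ball_zero_iff]
    refine (hsv v hv').trans_lt ((min_le_left _ _).trans_lt (by linarith))
  have h1 := hj1i (hinj (hmem v hv) (hmem w hw) hvw)
  exact smul_right_injective F hs0.ne' h1
end SphereAux

section CWAux

theorem aux_q (V : Type*) [NormedAddCommGroup V] [InnerProductSpace ℝ V] :
    ∃ (q : V → WithLp 2 (V × ℝ)) (s : WithLp 2 (V × ℝ)), Continuous q ∧ ‖s‖ = 1 ∧
      (∀ z, ‖z‖ ≤ 1 → ‖q z‖ = 1) ∧ (∀ z, ‖z‖ = 1 → q z = s) ∧ InjOn q (ball 0 1) ∧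
      (∀ z ∈ ball (0:V) 1, q z ≠ s) ∧ q 0 = -s := by
  refine ⟨fun z => WithLp.toLp 2 ((2 * √(1 - ‖z‖^2)) • z, 1 - 2 * ‖z‖^2), WithLp.toLp 2 (0, -1),
    ?_, ?_, ?_, ?_, ?_, ?_, ?_⟩
  · apply (WithLp.prod_continuous_toLp 2 V ℝ).comp
    fun_prop
  · have : ‖(WithLp.toLp 2 ((0:V), (-1:ℝ)))‖^2 = 1 := by
      rw [WithLp.prod_norm_sq_eq_of_L2]; simp
    nlinarith [norm_nonneg (WithLp.toLp 2 ((0:V), (-1:ℝ)))]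
  · intro z hz
    set w := WithLp.toLp 2 ((2 * √(1 - ‖z‖^2)) • z, 1 - 2 * ‖z‖^2) with hw
    have : ‖w‖^2 = 1 := by
      rw [WithLp.prod_norm_sq_eq_of_L2]
      change ‖(2 * √(1 - ‖z‖^2)) • z‖^2 + ‖1 - 2 * ‖z‖^2‖^2 = 1
      simp only [norm_smul, mul_pow, Real.norm_eq_abs, sq_abs]
      rw [Real.sq_sqrt (by nlinarith [norm_nonneg z])]
      ring
    nlinarith [norm_nonneg w]
  · intro z hz
    simp only [hz]; norm_num
  · intro z hz w hw h
    have h1 := congrArg (fun a => a.ofLp.1) h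
    have h2 := congrArg (fun a => a.ofLp.2) h
    simp only at h1 h2
    have h3 : ‖z‖^2 = ‖w‖^2 := by linarith
    rw [h3] at h1
    have hw' : ‖w‖ < 1 := by simpa using hw
    have h4 : 0 < √(1 - ‖w‖^2) := Real.sqrt_pos.2 (by nlinarith [norm_nonneg w])
    exact smul_right_injective V (by positivity : (2 * √(1 - ‖w‖^2)) ≠ 0) h1
  · intro z hz h
    have h2 := congrArg (fun a => a.ofLp.2) h
    simp only at h2
    have hz' : ‖z‖ < 1 := by simpa using hz
    nlinarith [norm_nonneg z]
  · simp [← WithLp.toLp_neg]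

theorem aux_unit_arith {F : Type*} [NormedAddCommGroup F] [InnerProductSpace ℝ F] (e v w : F)
    (he : ‖e‖ = 1) (hv : ‖v‖ = 1) (hw : ‖w‖ = 1) (t : ℝ) (ht0 : 0 ≤ t) (ht1 : t ≤ 1)
    (h : t • v + (1 - t) • (e - w) = (1/2 : ℝ) • e) : t = 1/2 ∧ v = w := by
  obtain ⟨a, rfl⟩ : ∃ a, v = a + (1/2 : ℝ) • e := ⟨v - (1/2 : ℝ) • e, by simp⟩
  obtain ⟨b, rfl⟩ : ∃ b, w = b + (1/2 : ℝ) • e := ⟨w - (1/2 : ℝ) • e, by simp⟩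
  have hab : t • a = (1 - t) • b := by
    have : t • a - (1 - t) • b =
      (t • (a + (1/2 : ℝ) • e) + (1 - t) • (e - (b + (1/2 : ℝ) • e))) - (1/2 : ℝ) • e := by module
    rw [← sub_eq_zero, this, h, sub_self]
  have hA : ‖a‖^2 + inner ℝ a e = 3/4 := by
    have := congrArg (· ^ 2) hv
    simp only [norm_add_sq_real, inner_smul_right, norm_smul, he] at this
    norm_num at this
    linarith
  have hB : ‖b‖^2 + inner ℝ b e = 3/4 := by
    have := congrArg (· ^ 2) hw
    simp only [norm_add_sq_real, inner_smul_right, norm_smul, he] at this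
    norm_num at this
    linarith
  have h1 : t * inner ℝ a e = (1 - t) * inner ℝ b e := by
    have := congrArg (fun z => inner ℝ z e) hab
    simpa [inner_smul_left] using this
  have h2 : t^2 * ‖a‖^2 = (1-t)^2 * ‖b‖^2 := by
    have := congrArg (fun z => ‖z‖^2) hab
    simpa [norm_smul, mul_pow] using this
  have hpos : 0 < 3/4 * t + (1 - t) * ‖b‖^2 := by
    rcases ht0.eq_or_lt with h0 | h0
    · rw [← h0] at h1 hab ⊢
      simp at hab
      rw [← hab] at hB
      norm_num at hB
    · have : 0 ≤ (1 - t) * ‖b‖^2 := mul_nonneg (by linarith) (by positivity)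
      linarith
  have h3 : (2 * t - 1) * (3/4 * t + (1 - t) * ‖b‖^2) = 0 := by
    have e1 : inner ℝ a e = 3/4 - ‖a‖^2 := by linarith
    have e2 : inner ℝ b e = 3/4 - ‖b‖^2 := by linarith
    rw [e1, e2] at h1
    linear_combination t * h1 + h2
  have h4 : t = 1/2 := by
    rcases mul_eq_zero.1 h3 with h5 | h5
    · linarith
    · linarith
  refine ⟨h4, ?_⟩
  rw [h4] at hab
  norm_num at hab
  rw [hab]

theorem aux_norm_normalize {E : Type*} [NormedAddCommGroup E] [NormedSpace ℝ E] {y : E} (hy : y ≠ 0) :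
    ‖‖y‖⁻¹ • y‖ = 1 := by
  rw [norm_smul, norm_inv, norm_norm, inv_mul_cancel₀ (norm_ne_zero_iff.2 hy)]

theorem aux_cone {E F : Type*} [NormedAddCommGroup E] [NormedSpace ℝ E]
    [NormedAddCommGroup F] [NormedSpace ℝ F] (ρ : E → F) (hρ : ContinuousOn ρ (sphere 0 1))
    (h1 : ∀ x, ‖ρ x‖ = 1) : Continuous (fun y : E => ‖y‖ • ρ (‖y‖⁻¹ • y)) := by
  rw [continuous_iff_continuousAt]
  intro y
  by_cases hy : y = 0
  · subst hy
    rw [ContinuousAt, norm_zero, zero_smul]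
    apply squeeze_zero_norm (a := fun y : E => ‖y‖)
    · intro y
      simp [norm_smul, h1]
    · simpa using (continuous_norm (E := E)).tendsto 0
  · apply ContinuousAt.smul continuous_norm.continuousAt
    have hc : ContinuousOn (fun y : E => ρ (‖y‖⁻¹ • y)) {0}ᶜ := by
      apply hρ.comp
      · exact ContinuousOn.smul (continuous_norm.continuousOn.inv₀ (fun x hx => norm_ne_zero_iff.2 hx))
          continuousOn_id
      · intro x hx
        simpa using aux_norm_normalize hx
    exact hc.continuousAt (isOpen_compl_singleton.mem_nhds hy)

namespace CWComplexCells

variable {X : Type} [TopologicalSpace X] [T2Space X] (K : CWComplexCells X)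

theorem aux_cell_unique {c c' : K.Cell} {y y'} (hy : y ∈ ball 0 1) (hy' : y' ∈ ball 0 1)
    (h : K.charMap c y = K.charMap c' y') : c = c' := by
  by_contra hne
  exact Set.disjoint_left.1 (K.cells_disjoint c c' hne) ⟨y, hy, rfl⟩ (h ▸ ⟨y', hy', rfl⟩)

theorem aux_exists_cell (x : X) : ∃ c, ∃ y ∈ ball 0 1, K.charMap c y = x := by
  have : x ∈ ⋃ τ : K.Cell, K.charMap τ '' ball 0 1 := by rw [K.cells_cover]; trivial
  obtain ⟨c, y, hy, h⟩ := mem_iUnion.1 this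
  exact ⟨c, y, hy, h⟩

theorem aux_glue {F : Type*} (gg : ∀ c : K.Cell, EuclideanSpace ℝ (Fin (K.dim c)) → F) :
    ∃ G : X → F, ∀ c, ∀ y ∈ ball 0 1, G (K.charMap c y) = gg c y := by
  choose cell coord hb hx using K.aux_exists_cell
  refine ⟨fun x => gg (cell x) (coord x), fun c y hy => ?_⟩
  have h1 := hx (K.charMap c y)
  have h2 := hb (K.charMap c y)
  beta_reduce
  generalize coord (K.charMap c y) = y' at *
  generalize cell (K.charMap c y) = c' at *
  obtain rfl := K.aux_cell_unique h2 hy h1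
  rw [K.charMap_injOn _ h2 hy h1]

theorem aux_sphere_cell (c : K.Cell) {y} (hy : y ∈ sphere 0 1) :
    ∃ ρ, K.dim ρ < K.dim c ∧ ∃ z ∈ ball 0 1, K.charMap ρ z = K.charMap c y := by
  obtain ⟨I, -, hd, hs⟩ := K.sphere_subset c
  obtain ⟨ρ, hρ, z, hz, h⟩ := mem_iUnion₂.1 (hs ⟨y, hy, rfl⟩)
  exact ⟨ρ, hd ρ hρ, z, hz, h⟩

theorem aux_closed_disjoint {c ρ : K.Cell} (hne : c ≠ ρ) (hd : K.dim c ≤ K.dim ρ) {y}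
    (hy : y ∈ closedBall 0 1) : K.charMap c y ∉ K.cellSet ρ := by
  rintro ⟨z, hz, h⟩
  rw [← ball_union_sphere] at hy
  rcases hy with hy | hy
  · exact hne (K.aux_cell_unique hy hz h.symm)
  · obtain ⟨ρ', hd', z', hz', h'⟩ := K.aux_sphere_cell c hy
    obtain rfl := K.aux_cell_unique hz hz' (h.trans h'.symm)
    omega

theorem aux_isCompact (c : K.Cell) : IsCompact (K.charMap c '' closedBall 0 1) :=
  (isCompact_closedBall _ _).image_of_continuousOn (K.charMap_continuousOn c)

theorem aux_continuousOn {F : Type*} [TopologicalSpace F] (I : Set K.Cell) (hI : I.Finite)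
    (Y : Set X) (hY : IsClosed Y) (hYI : Y ⊆ ⋃ ρ ∈ I, K.charMap ρ '' closedBall 0 1)
    (g : X → F) (hg : ∀ ρ ∈ I, ContinuousOn (fun y => g (K.charMap ρ y))
      (closedBall 0 1 ∩ K.charMap ρ ⁻¹' Y)) : ContinuousOn g Y := by
  rw [continuousOn_iff_isClosed]
  intro t ht
  refine ⟨g ⁻¹' t ∩ Y, ?_, by rw [inter_assoc, inter_self]⟩
  have h1 : g ⁻¹' t ∩ Y = ⋃ ρ ∈ I, K.charMap ρ '' ((closedBall 0 1 ∩ K.charMap ρ ⁻¹' Y) ∩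
      (fun y => g (K.charMap ρ y)) ⁻¹' t) := by
    ext x
    constructor
    · rintro ⟨hx, hxY⟩
      obtain ⟨ρ, hρ, y, hy, rfl⟩ := mem_iUnion₂.1 (hYI hxY)
      exact mem_iUnion₂.2 ⟨ρ, hρ, y, ⟨⟨hy, hxY⟩, hx⟩, rfl⟩
    · intro hx
      obtain ⟨ρ, hρ, y, ⟨⟨hy, hxY⟩, hxt⟩, rfl⟩ := mem_iUnion₂.1 hx
      exact ⟨hxt, hxY⟩
  rw [h1]
  refine hI.isClosed_biUnion fun ρ hρ => ?_
  have hc := K.charMap_continuousOn ρ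
  have c1 : IsClosed (closedBall 0 1 ∩ K.charMap ρ ⁻¹' Y) :=
    hc.preimage_isClosed_of_isClosed isClosed_closedBall hY
  have c2 := (hg ρ hρ).preimage_isClosed_of_isClosed c1 ht
  have c3 : IsCompact ((closedBall 0 1 ∩ K.charMap ρ ⁻¹' Y) ∩
      (fun y => g (K.charMap ρ y)) ⁻¹' t) :=
    (isCompact_closedBall _ _).of_isClosed_subset c2 (fun y hy => hy.1.1)
  exact (c3.image_of_continuousOn (hc.mono fun y hy => hy.1.1)).isClosed

theorem aux_regular_inj {a b : K.Cell} (h : K.RegularFace a b) :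
    InjOn (K.charMap b) (K.preim a b) := by
  obtain ⟨-, ⟨e, he⟩, -⟩ := h
  intro x hx y hy hxy
  have : e ⟨x, hx⟩ = e ⟨y, hy⟩ := Subtype.ext (by rw [he, he]; exact hxy)
  exact congrArg Subtype.val (e.injective this)

end CWComplexCells
end CWAux

namespace CWComplexCells

variable {X : Type} [TopologicalSpace X] [T2Space X] (K : CWComplexCells X)

/-- the map to the sphere collapsing everything outside the cell `ν` -/
theorem aux_exists_r {F : Type*} [NormedAddCommGroup F] (ν : K.Cell)
    (q : EuclideanSpace ℝ (Fin (K.dim ν)) → F) (s : F)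
    (hq : Continuous q) (hs : ‖s‖ = 1)
    (hqn : ∀ z, ‖z‖ ≤ 1 → ‖q z‖ = 1) (hqs : ∀ z, ‖z‖ = 1 → q z = s)
    (hqi : InjOn q (ball 0 1)) (hqne : ∀ z ∈ ball 0 1, q z ≠ s) :
    ∃ r : X → F, (∀ z ∈ ball 0 1, r (K.charMap ν z) = q z) ∧ (∀ x ∉ K.cellSet ν, r x = s) ∧
      (∀ x, ‖r x‖ = 1) ∧ (∀ w ∈ K.cellSet ν, ∀ x, r x = r w → x = w) ∧
      (∀ c, K.dim c ≤ K.dim ν → ContinuousOn (fun y => r (K.charMap c y)) (closedBall 0 1)) ∧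
      (∀ c, K.dim c = K.dim ν + 1 → ContinuousOn (fun y => r (K.charMap c y)) (sphere 0 1)) := by
  classical
  obtain ⟨r, hr1, hr2⟩ : ∃ r : X → F, (∀ z ∈ ball 0 1, r (K.charMap ν z) = q z) ∧
      (∀ x ∉ K.cellSet ν, r x = s) := by
    refine ⟨fun x => if x ∈ K.cellSet ν then
      q (Function.invFunOn (K.charMap ν) (ball 0 1) x) else s, ?_, ?_⟩
    · intro z hz
      have h1 : K.charMap ν z ∈ K.cellSet ν := ⟨z, hz, rfl⟩
      simp only [h1, if_true]
      rw [(K.charMap_injOn ν).leftInvOn_invFunOn hz]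
    · intro x hx
      simp only [hx, if_false]
  have hlow : ∀ c, K.dim c ≤ K.dim ν →
      ContinuousOn (fun y => r (K.charMap c y)) (closedBall 0 1) := by
    intro c hc
    by_cases hcν : c = ν
    · subst hcν
      apply hq.continuousOn.congr
      intro y hy
      rw [← ball_union_sphere] at hy
      rcases hy with hy | hy
      · exact hr1 y hy
      · simp only
        rw [hqs y (by simpa using hy)]
        apply hr2
        rintro ⟨z, hz, h⟩
        obtain ⟨ρ, hd, z', hz', h'⟩ := K.aux_sphere_cell c hy
        obtain rfl := K.aux_cell_unique hz' hz (h'.trans h.symm)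
        omega
    · apply (continuousOn_const (c := s)).congr
      intro y hy
      exact hr2 _ (K.aux_closed_disjoint hcν hc hy)
  refine ⟨r, hr1, hr2, ?_, ?_, hlow, ?_⟩
  · intro x
    by_cases hx : x ∈ K.cellSet ν
    · obtain ⟨z, hz, rfl⟩ := hx
      rw [hr1 z hz]
      exact hqn z (le_of_lt (by simpa using hz))
    · rw [hr2 x hx, hs]
  · rintro w ⟨z, hz, rfl⟩ x h
    rw [hr1 z hz] at h
    by_cases hx : x ∈ K.cellSet ν
    · obtain ⟨z', hz', rfl⟩ := hx
      rw [hr1 z' hz'] at h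
      rw [hqi hz' hz h]
    · rw [hr2 x hx] at h
      exact absurd h.symm (hqne z hz)
  · intro c hc
    obtain ⟨I, hI, hd, hsub⟩ := K.sphere_subset c
    have hcs := (K.charMap_continuousOn c).mono sphere_subset_closedBall
    have hcl : IsClosed (K.charMap c '' sphere 0 1) :=
      ((isCompact_sphere _ _).image_of_continuousOn hcs).isClosed
    have hY := K.aux_continuousOn I hI _ hcl
      (hsub.trans (iUnion₂_mono fun ρ _ => image_mono ball_subset_closedBall)) r
      (fun ρ hρ => (hlow ρ (by have := hd ρ hρ; omega)).mono inter_subset_left)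
    exact hY.comp hcs (fun y hy => ⟨y, hy, rfl⟩)

theorem aux_cell_map {F : Type*} [NormedAddCommGroup F] [InnerProductSpace ℝ F]
    (ν σ τ : K.Cell) (hσ : K.dim σ = K.dim ν + 1) (hτ : K.dim τ = K.dim σ + 1)
    (hno : ¬ ∃ σ', σ' ≠ σ ∧ K.Facet ν σ' ∧ K.Facet σ' τ)
    (r : X → F) (e : F) (he : ‖e‖ = 1) (hrn : ∀ x, ‖r x‖ = 1)
    (hru : ∀ w ∈ K.cellSet ν, ∀ x, r x = r w → x = w)
    (hrl : ∀ c, K.dim c ≤ K.dim ν → ContinuousOn (fun y => r (K.charMap c y)) (closedBall 0 1))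
    (hrs : ∀ c, K.dim c = K.dim ν + 1 → ContinuousOn (fun y => r (K.charMap c y)) (sphere 0 1))
    (c : K.Cell) (hc : K.dim c ≤ K.dim σ) :
    ∃ g : EuclideanSpace ℝ (Fin (K.dim c)) → F,
      ContinuousOn g (closedBall 0 1 ∩ K.charMap c ⁻¹' (K.charMap τ '' sphere 0 1)) ∧
      (K.dim c < K.dim σ → ∀ y, g y = r (K.charMap c y)) ∧
      (∀ y, ‖y‖ = 1 → g y = r (K.charMap c y)) ∧
      (c ≠ σ → ∀ y ∈ closedBall 0 1, K.charMap c y ∈ K.charMap τ '' sphere 0 1 →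
        g y ≠ (1/2 : ℝ) • e) ∧
      (c = σ → ∀ y, g y = ‖y‖ • r (K.charMap c (‖y‖⁻¹ • y))) := by
  have hhalf : ∀ x, r x ≠ (1/2 : ℝ) • e := by
    intro x h
    have := congrArg norm h
    rw [hrn, norm_smul, he] at this
    norm_num at this
  by_cases hlt : K.dim c < K.dim σ
  · refine ⟨fun y => r (K.charMap c y), (hrl c (by omega)).mono inter_subset_left,
      fun _ _ => rfl, fun _ _ => rfl, fun _ _ _ _ => hhalf _, ?_⟩
    rintro rfl
    omega
  have hck : K.dim c = K.dim ν + 1 := by omega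
  have hcone := aux_cone (fun y => r (K.charMap c y)) (hrs c hck) (fun y => hrn _)
  by_cases hcσ : c = σ
  · exact ⟨fun y => ‖y‖ • r (K.charMap c (‖y‖⁻¹ • y)), hcone.continuousOn, fun h => absurd h hlt,
      fun y hy => by simp [hy], fun h => absurd hcσ h, fun _ _ => rfl⟩
  by_cases hp : ∃ p ∈ ball 0 1, K.charMap c p ∉ K.charMap τ '' sphere 0 1
  · obtain ⟨p, hp, hpY⟩ := hp
    have hp1 : ‖p‖ < 1 := by simpa using hp
    set u : EuclideanSpace ℝ (Fin (K.dim c)) → EuclideanSpace ℝ (Fin (K.dim c)) :=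
      fun y => y - ((1 - ‖y‖) / (1 - ‖p‖)) • p with hu
    have huc : Continuous u := by
      apply continuous_id.sub
      exact ((continuous_const.sub continuous_norm).div_const _).smul continuous_const
    have hu0 : ∀ y ∈ closedBall 0 1, K.charMap c y ∈ K.charMap τ '' sphere 0 1 → u y ≠ 0 := by
      intro y hy hyY h0
      have hy1 : ‖y‖ ≤ 1 := by simpa using hy
      have h1 : y = ((1 - ‖y‖) / (1 - ‖p‖)) • p := sub_eq_zero.1 h0
      have h2 : ‖y‖ = (1 - ‖y‖) / (1 - ‖p‖) * ‖p‖ := by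
        conv_lhs => rw [h1]
        rw [norm_smul, Real.norm_of_nonneg (div_nonneg (by linarith) (by linarith))]
      have h3 : ‖y‖ = ‖p‖ := by
        have h4 : 1 - ‖p‖ ≠ 0 := by linarith
        field_simp at h2
        linarith
      rw [h3, div_self (by linarith), one_smul] at h1
      exact hpY (h1 ▸ hyY)
    refine ⟨fun y => r (K.charMap c (‖u y‖⁻¹ • u y)), ?_, fun h => absurd h hlt, ?_,
      fun _ _ _ _ => hhalf _, fun h => absurd h hcσ⟩
    · apply (hrs c hck).comp
      · exact ContinuousOn.smul (huc.norm.continuousOn.inv₀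
          (fun y hy => norm_ne_zero_iff.2 (hu0 y hy.1 hy.2))) huc.continuousOn
      · intro y hy
        simpa using aux_norm_normalize (hu0 y hy.1 hy.2)
    · intro y hy
      have : u y = y := by simp [hu, hy]
      simp [this, hy]
  · push Not at hp
    have hface : K.Facet c τ := by
      refine ⟨?_, by omega⟩
      rintro x ⟨y, hy, rfl⟩
      refine ⟨?_, ?_⟩
      · rw [cellSet, K.closure_cell]
        exact image_mono sphere_subset_closedBall (hp y hy)
      · rintro ⟨z, hz, h⟩
        have := K.aux_cell_unique hz hy h
        rw [this] at hτ
        omega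
    have hnf : ¬ K.Face ν c := fun h => hno ⟨c, hcσ, ⟨h, by omega⟩, hface⟩
    obtain ⟨w, hw, hwc⟩ : ∃ w ∈ K.cellSet ν, w ∉ K.charMap c '' closedBall 0 1 := by
      by_contra hcon
      push Not at hcon
      apply hnf
      intro w hw
      refine ⟨by rw [cellSet, K.closure_cell]; exact hcon w hw, ?_⟩
      obtain ⟨z, hz, rfl⟩ := hw
      rintro ⟨z', hz', h⟩
      have := K.aux_cell_unique hz' hz h
      rw [this] at hck
      omega
    refine ⟨fun y => ‖y‖ • r (K.charMap c (‖y‖⁻¹ • y)) + (1 - ‖y‖) • (e - r w), ?_,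
      fun h => absurd h hlt, fun y hy => by simp [hy], ?_, fun h => absurd h hcσ⟩
    · apply Continuous.continuousOn
      exact hcone.add ((continuous_const.sub continuous_norm).smul continuous_const)
    · intro _ y hy _ h
      have hy1 : ‖y‖ ≤ 1 := by simpa using hy
      obtain ⟨ht, hvw⟩ := aux_unit_arith e _ _ he (hrn _) (hrn _) ‖y‖ (norm_nonneg _) hy1 h
      have h0 : y ≠ 0 := by rintro rfl; norm_num at ht
      apply hwc
      rw [← hru w hw _ hvw]
      exact ⟨_, by simp [aux_norm_normalize h0], rfl⟩

theorem aux_diamond_core {F : Type*} [NormedAddCommGroup F] [InnerProductSpace ℝ F]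
    [FiniteDimensional ℝ F]
    (ν σ τ : K.Cell) (hνσ : K.RegularFace ν σ) (hστ : K.RegularFace σ τ)
    (hσ : K.dim σ = K.dim ν + 1) (hτ : K.dim τ = K.dim σ + 1)
    (hF : Module.finrank ℝ F = K.dim ν + 1)
    (hno : ¬ ∃ σ', σ' ≠ σ ∧ K.Facet ν σ' ∧ K.Facet σ' τ)
    (r : X → F) (s : F) (hs : ‖s‖ = 1) (hrs' : ∀ x ∉ K.cellSet ν, r x = s)
    (hr0 : r (K.charMap ν 0) = -s) (hrn : ∀ x, ‖r x‖ = 1)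
    (hru : ∀ w ∈ K.cellSet ν, ∀ x, r x = r w → x = w)
    (hrl : ∀ c, K.dim c ≤ K.dim ν → ContinuousOn (fun y => r (K.charMap c y)) (closedBall 0 1))
    (hrs : ∀ c, K.dim c = K.dim ν + 1 → ContinuousOn (fun y => r (K.charMap c y)) (sphere 0 1)) :
    False := by
  set e : F := -s with he_def
  have he : ‖e‖ = 1 := by rw [he_def, norm_neg, hs]
  set Y : Set X := K.charMap τ '' sphere 0 1 with hYdef
  have hgg : ∀ c : K.Cell, ∃ g : EuclideanSpace ℝ (Fin (K.dim c)) → F, K.dim c ≤ K.dim σ →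
      ContinuousOn g (closedBall 0 1 ∩ K.charMap c ⁻¹' Y) ∧
      (K.dim c < K.dim σ → ∀ y, g y = r (K.charMap c y)) ∧
      (∀ y, ‖y‖ = 1 → g y = r (K.charMap c y)) ∧
      (c ≠ σ → ∀ y ∈ closedBall 0 1, K.charMap c y ∈ Y → g y ≠ (1/2 : ℝ) • e) ∧
      (c = σ → ∀ y, g y = ‖y‖ • r (K.charMap c (‖y‖⁻¹ • y))) := by
    intro c
    by_cases hc : K.dim c ≤ K.dim σ
    · obtain ⟨g, hg⟩ := K.aux_cell_map ν σ τ hσ hτ hno r e he hrn hru hrl hrs c hc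
      exact ⟨g, fun _ => hg⟩
    · exact ⟨fun _ => 0, fun h => absurd h hc⟩
  choose gg hgg using hgg
  obtain ⟨G, hG⟩ := K.aux_glue gg
  have hGc : ∀ c, K.dim c ≤ K.dim σ → ∀ y ∈ closedBall 0 1, G (K.charMap c y) = gg c y := by
    intro c hc y hy
    rw [← ball_union_sphere] at hy
    rcases hy with hy | hy
    · exact hG c y hy
    · obtain ⟨ρ, hd, z, hz, h⟩ := K.aux_sphere_cell c hy
      rw [← h, hG ρ z hz, (hgg ρ (by omega)).2.1 (by omega), h,
        (hgg c hc).2.2.1 y (by simpa using hy)]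
  have hGσ : ∀ y ∈ closedBall 0 1, G (K.charMap σ y) = ‖y‖ • r (K.charMap σ (‖y‖⁻¹ • y)) := by
    intro y hy
    rw [hGc σ le_rfl y hy, (hgg σ le_rfl).2.2.2.2 rfl]
  obtain ⟨I, hI, hId, hIs⟩ := K.sphere_subset τ
  have hcs := (K.charMap_continuousOn τ).mono sphere_subset_closedBall
  have hYcl : IsClosed Y := ((isCompact_sphere _ _).image_of_continuousOn hcs).isClosed
  have hGY : ContinuousOn G Y := by
    apply K.aux_continuousOn I hI Y hYcl
      (hIs.trans (iUnion₂_mono fun ρ _ => image_mono ball_subset_closedBall)) G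
    intro ρ hρ
    have hd : K.dim ρ ≤ K.dim σ := by have := hId ρ hρ; omega
    exact (hgg ρ hd).1.congr (fun y hy => hGc ρ hd y hy.1)
  have hGτ : ContinuousOn (fun x => G (K.charMap τ x)) (sphere 0 1) :=
    hGY.comp hcs (fun y hy => ⟨y, hy, rfl⟩)
  have hinj1 := K.aux_regular_inj hνσ
  have hinj2 := K.aux_regular_inj hστ
  have hface : ∀ a b : K.Cell, K.Face a b → ∀ w ∈ K.cellSet a, ∃ n, ‖n‖ = 1 ∧ K.charMap b n = w := by
    intro a b hab w hw
    obtain ⟨h1, h2⟩ := hab hw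
    rw [cellSet, K.closure_cell] at h1
    obtain ⟨n, hn, rfl⟩ := h1
    refine ⟨n, ?_, rfl⟩
    rw [← ball_union_sphere] at hn
    rcases hn with hn | hn
    · exact absurd ⟨n, hn, rfl⟩ h2
    · simpa using hn
  obtain ⟨n0, hn0, hn0'⟩ := hface ν σ hνσ.1 (K.charMap ν 0) ⟨0, by simp, rfl⟩
  have hhn : ‖(1/2 : ℝ) • n0‖ = 1/2 := by rw [norm_smul, hn0]; norm_num
  have hhb : (1/2 : ℝ) • n0 ∈ ball 0 1 := by rw [mem_ball_zero_iff, hhn]; norm_num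
  obtain ⟨x0, hx0, hx0'⟩ := hface σ τ hστ.1 (K.charMap σ ((1/2 : ℝ) • n0)) ⟨_, hhb, rfl⟩
  have hGx0 : G (K.charMap τ x0) = (1/2 : ℝ) • e := by
    rw [hx0', hGσ _ (ball_subset_closedBall hhb), hhn, smul_smul]
    norm_num
    rw [hn0', hr0]
  have hpre : ∀ y, ‖y‖ = 1 → K.charMap σ y ∈ K.cellSet ν → y ∈ K.preim ν σ := fun y hy h =>
    ⟨by simp [hy], h⟩
  have hpre2 : ∀ x, ‖x‖ = 1 → K.charMap τ x ∈ K.cellSet σ → x ∈ K.preim σ τ := fun y hy h =>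
    ⟨by simp [hy], h⟩
  set O : Set (EuclideanSpace ℝ (Fin (K.dim τ))) :=
    {x | K.charMap τ x ∈ K.cellSet σ ∧ inner ℝ s (G (K.charMap τ x)) < 0} with hOdef
  refine aux_sphere (E := EuclideanSpace ℝ (Fin (K.dim τ))) (F := F) ?_
    (fun x => G (K.charMap τ x) - (1/2 : ℝ) • e) (hGτ.sub continuousOn_const) x0 hx0
    (sub_eq_zero.2 hGx0) ?_ O ?_ ?_
  · rw [hF, finrank_euclideanSpace_fin]; omega
  · intro x hx hGx
    have hGx := sub_eq_zero.1 hGx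
    obtain ⟨c, hcI, y, hy, hyx⟩ := mem_iUnion₂.1 (hIs ⟨x, by simpa using hx, rfl⟩)
    have hcd : K.dim c ≤ K.dim σ := by have := hId c hcI; omega
    have hcY : K.charMap c y ∈ Y := hyx ▸ ⟨x, by simpa using hx, rfl⟩
    rw [← hyx, hG c y hy] at hGx
    have hcσ : c = σ := by
      by_contra hne
      exact (hgg c hcd).2.2.2.1 hne y (ball_subset_closedBall hy) hcY hGx
    subst hcσ
    rw [(hgg c hcd).2.2.2.2 rfl] at hGx
    have hyn : ‖y‖ = 1/2 := by
      have := congrArg norm hGx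
      rw [norm_smul, norm_smul, hrn, he] at this
      simpa using this
    have hy0 : y ≠ 0 := by rintro rfl; norm_num at hyn
    have h2 : r (K.charMap c (‖y‖⁻¹ • y)) = r (K.charMap ν 0) := by
      rw [hr0]
      rw [hyn] at hGx ⊢
      exact smul_right_injective F (by norm_num : (1/2:ℝ) ≠ 0) hGx
    have hν0 : K.charMap ν 0 ∈ K.cellSet ν := ⟨0, by simp, rfl⟩
    have h3 := hru _ hν0 _ h2
    have h4 : ‖y‖⁻¹ • y = n0 := hinj1 (hpre _ (aux_norm_normalize hy0) (h3 ▸ hν0))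
      (hpre _ hn0 (hn0' ▸ hν0)) (h3.trans hn0'.symm)
    have h5 : y = (1/2 : ℝ) • n0 := by
      rw [← h4, hyn, smul_smul]; norm_num
    have h6 : K.charMap τ x = K.charMap τ x0 := by rw [← hyx, hx0', h5]
    exact hinj2 (hpre2 x hx (hyx ▸ ⟨y, hy, rfl⟩)) (hpre2 x0 hx0 (hx0' ▸ ⟨_, hhb, rfl⟩)) h6
  · set A : Set X := ⋃ ρ ∈ I \ {σ}, K.charMap ρ '' closedBall 0 1 with hA
    have hAcl : IsClosed A := (hI.subset sdiff_subset).isClosed_biUnion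
      (fun ρ _ => (K.aux_isCompact ρ).isClosed)
    have hx0s : x0 ∈ sphere (0 : EuclideanSpace ℝ (Fin (K.dim τ))) 1 := by simpa using hx0
    have hx0A : K.charMap τ x0 ∈ Aᶜ := by
      intro h
      obtain ⟨ρ, ⟨hρ, hne⟩, y, hy, hyx⟩ := mem_iUnion₂.1 h
      refine K.aux_closed_disjoint (c := ρ) (ρ := σ) hne (by have := hId ρ hρ; omega) hy ?_
      rw [hyx, hx0']
      exact ⟨_, hhb, rfl⟩
    have e1 : ∀ᶠ x in nhdsWithin x0 (sphere 0 1), K.charMap τ x ∈ Aᶜ :=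
      (hcs x0 hx0s).eventually_mem (hAcl.isOpen_compl.mem_nhds hx0A)
    have e2 : ∀ᶠ x in nhdsWithin x0 (sphere 0 1), inner ℝ s (G (K.charMap τ x)) < 0 := by
      have hc : ContinuousWithinAt (fun x => inner ℝ s (G (K.charMap τ x))) (sphere 0 1) x0 :=
        ContinuousWithinAt.inner (𝕜 := ℝ) continuousWithinAt_const (hGτ x0 hx0s)
      apply hc.eventually_lt continuousWithinAt_const
      beta_reduce
      rw [hGx0, he_def, inner_smul_right, inner_neg_right, real_inner_self_eq_norm_sq, hs]
      norm_num
    filter_upwards [e1, e2, self_mem_nhdsWithin] with x hx1 hx2 hx3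
    refine ⟨?_, hx2⟩
    obtain ⟨c, hcI, y, hy, hyx⟩ := mem_iUnion₂.1 (hIs ⟨x, hx3, rfl⟩)
    by_cases hcσ : c = σ
    · subst hcσ
      exact ⟨y, hy, hyx⟩
    · exact hx1 (mem_iUnion₂.2 ⟨c, ⟨hcI, hcσ⟩, y, ball_subset_closedBall hy, hyx⟩) |>.elim
  · have key : ∀ y ∈ ball 0 1, inner ℝ s (G (K.charMap σ y)) < 0 → y ≠ 0 ∧
        K.charMap σ (‖y‖⁻¹ • y) ∈ K.cellSet ν := by
      intro y hy h
      rw [hGσ y (ball_subset_closedBall hy)] at h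
      refine ⟨by rintro rfl; simp at h, ?_⟩
      by_contra hcon
      rw [hrs' _ hcon, inner_smul_right, real_inner_self_eq_norm_sq, hs] at h
      linarith [norm_nonneg y]
    rintro x ⟨⟨⟨y, hy, hyx⟩, hx2⟩, hxs⟩ x' ⟨⟨⟨y', hy', hyx'⟩, hx2'⟩, hxs'⟩ h
    have h := sub_left_injective h
    rw [← hyx] at hx2 h
    rw [← hyx'] at hx2' h
    obtain ⟨hy0, hyν⟩ := key y hy hx2
    obtain ⟨hy0', hyν'⟩ := key y' hy' hx2'
    rw [hGσ y (ball_subset_closedBall hy), hGσ y' (ball_subset_closedBall hy')] at h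
    have hnn : ‖y‖ = ‖y'‖ := by
      have := congrArg norm h
      simpa [norm_smul, hrn] using this
    have hyn := norm_ne_zero_iff.2 hy0
    have h1 : r (K.charMap σ (‖y‖⁻¹ • y)) = r (K.charMap σ (‖y'‖⁻¹ • y')) := by
      rw [← hnn] at h ⊢
      exact smul_right_injective F hyn h
    have h2 := hinj1 (hpre _ (aux_norm_normalize hy0) hyν) (hpre _ (aux_norm_normalize hy0') hyν')
      (hru _ hyν' _ h1)
    rw [← hnn] at h2
    have h3 : y = y' := smul_right_injective _ (inv_ne_zero hyn) h2
    exact hinj2 (hpre2 x (by simpa using hxs) (hyx ▸ ⟨y, hy, rfl⟩))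
      (hpre2 x' (by simpa using hxs') (hyx' ▸ ⟨y', hy', rfl⟩)) (by rw [← hyx, ← hyx', h3])

/-- the diamond property -/
theorem aux_diamond (ν σ τ : K.Cell) (hνσ : K.RegularFace ν σ) (hστ : K.RegularFace σ τ)
    (hσ : K.dim ν + 1 = K.dim σ) (hτ : K.dim σ + 1 = K.dim τ) :
    ∃ σ', σ' ≠ σ ∧ K.Facet ν σ' ∧ K.Facet σ' τ := by
  by_contra hno
  obtain ⟨q, s, hq, hs, hqn, hqs, hqi, hqne, hq0⟩ := aux_q (EuclideanSpace ℝ (Fin (K.dim ν)))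
  obtain ⟨r, hr1, hr2, hr3, hr4, hr5, hr6⟩ := K.aux_exists_r ν q s hq hs hqn hqs hqi hqne
  have hF : Module.finrank ℝ (WithLp 2 (EuclideanSpace ℝ (Fin (K.dim ν)) × ℝ)) = K.dim ν + 1 := by
    rw [(WithLp.linearEquiv 2 ℝ (EuclideanSpace ℝ (Fin (K.dim ν)) × ℝ)).finrank_eq,
      Module.finrank_prod, finrank_euclideanSpace_fin, Module.finrank_self]
  have : FiniteDimensional ℝ (WithLp 2 (EuclideanSpace ℝ (Fin (K.dim ν)) × ℝ)) :=
    Module.finite_of_finrank_pos (by omega)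
  exact K.aux_diamond_core ν σ τ hνσ hστ hσ.symm hτ.symm hF hno r s hs hr2
    ((hr1 0 (by simp)).trans hq0) hr3 hr4 hr5 hr6

end CWComplexCells

/-- Lemma `lemma:one`: for a discrete Morse function `f` and every
cell `σ`, `U(σ) + D(σ) ≤ 1`. -/
theorem U_add_D_le_one_of_discreteMorse {X : Type} [TopologicalSpace X] [T2Space X]
    (K : CWComplexCells X) (f : K.Cell → ℝ) (hf : K.DiscreteMorse f) :
    ∀ σ : K.Cell, K.U f σ + K.D f σ ≤ 1 := by
  intro σ
  have hU := (hf σ).2.1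
  have hD := (hf σ).2.2.2
  by_cases hU0 : K.Uset f σ = ∅
  · rw [CWComplexCells.U, hU0, encard_empty, zero_add]; exact hD
  by_cases hD0 : K.Dset f σ = ∅
  · rw [CWComplexCells.D, hD0, encard_empty, add_zero]; exact hU
  exfalso
  obtain ⟨τ, hτ, hfτ⟩ := nonempty_iff_ne_empty.2 hU0
  obtain ⟨ν, hν, hfν⟩ := nonempty_iff_ne_empty.2 hD0
  have r1 : K.RegularFace σ τ := by
    by_contra h
    exact absurd ((hf σ).1 τ ⟨hτ, h⟩) (not_lt.2 hfτ)
  have r2 : K.RegularFace ν σ := by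
    by_contra h
    exact absurd ((hf σ).2.2.1 ν ⟨hν, h⟩) (not_lt.2 hfν)
  obtain ⟨σ', hne, h1, h2⟩ := K.aux_diamond ν σ τ r2 r1 hν.2 hτ.2
  have a1 : f ν < f σ' := by
    by_contra h
    exact hne (encard_le_one_iff.1 (hf ν).2.1 σ' σ ⟨h1, not_lt.1 h⟩ ⟨hν, hfν⟩)
  have a2 : f σ' < f τ := by
    by_contra h
    exact hne (encard_le_one_iff.1 (hf τ).2.2.2 σ' σ ⟨h2, not_lt.1 h⟩ ⟨hτ, hfτ⟩)
  linarith [ge_iff_le.1 hfτ, ge_iff_le.1 hfν]
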